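/- There exists a constant c3 > 0 such that for all sufficiently large n and all nodes x, t of a KSWN* on n nodes with m = Dist(x,t) ≥ 2, the probability that the K-neighbor of x lies in the ball B_{m/2}(t) is at least c3/log₂ n. -/

import Mathlib

open scoped Classical BigOperators ENNReal

noncomputable section

/-- Ring (Manhattan) distance on the cycle `ZMod n`:
`Dist(u,v) = min((v-u) mod n, (u-v) mod n)`. -/
def ringDist (n : ℕ) (u v : ZMod n) : ℕ := min (v - u).val (u - v).val

/-- The harmonic normalization constant `Z_u = Σ_{z ≠ u} 1 / Dist(u,z)`. -/
def Zconst (n : ℕ) (u : ZMod n) : ℝ :=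
  ∑' z : ZMod n, if z = u then 0 else ((ringDist n u z : ℝ))⁻¹

/-- Probability that the K-link of `u` points to `v`:
`Pr[u → v] = 1 / (Z_u · Dist(u,v))` for `v ≠ u`. -/
def kProb (n : ℕ) (u v : ZMod n) : ℝ :=
  if v = u then 0 else (Zconst n u * (ringDist n u v : ℝ))⁻¹

/-- The number `⌈(log₂ n)²⌉` of candidate AL-neighbours of a node. -/
def alCount (n : ℕ) : ℕ := ⌈(Real.logb 2 n) ^ 2⌉₊

/-- Probability that a single AL-link of `u` points to `v`: the link is chosen
uniformly among the nodes `u+1, …, u+⌈(log₂ n)²⌉` (mod n). -/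
def alProb (n : ℕ) (u v : ZMod n) : ℝ :=
  if ∃ i ∈ Finset.Icc 1 (alCount n), u + (i : ZMod n) = v then ((alCount n : ℝ))⁻¹ else 0

/-- A realization of all the random links of a KSWN* on `n` nodes:
for each node its K-neighbour and its two AL-neighbours. -/
structure Config (n : ℕ) where
  K : ZMod n → ZMod n
  AL : ZMod n → Fin 2 → ZMod n

/-- Probability weight of a configuration: all links are mutually independent. -/
def configProb (n : ℕ) (c : Config n) : ℝ :=
  (∏' u : ZMod n, kProb n u (c.K u)) *
    ∏' u : ZMod n, (alProb n u (c.AL u 0) * alProb n u (c.AL u 1))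

/-- Probability of an event over the random construction of the KSWN*. -/
def Pr (n : ℕ) (E : Config n → Prop) : ℝ :=
  ∑' c : Config n, if E c then configProb n c else 0

/-- The `i`-th level `T_i` of the AL-neighbourhood of `x`. -/
def levelT (n : ℕ) (c : Config n) (x : ZMod n) : ℕ → Finset (ZMod n)
  | 0 => {x}
  | i + 1 => (levelT n c x i).biUnion fun u => {c.AL u 0, c.AL u 1}

/-- The AL-awareness `A_x(k) = H_k = ∪_{j ≤ k} T_j`. -/
def aware (n : ℕ) (c : Config n) (x : ZMod n) (k : ℕ) : Finset (ZMod n) :=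
  (Finset.range (k + 1)).biUnion (levelT n c x)

/-- `⌈log₂ log₂ n⌉`, the number of awareness levels used by the algorithms. -/
def kstar (n : ℕ) : ℕ := ⌈Real.logb 2 (Real.logb 2 n)⌉₊

/-- The distance threshold `(log₂ n)² · log₂ log₂ n`. -/
def thresh (n : ℕ) : ℝ := (Real.logb 2 n) ^ 2 * Real.logb 2 (Real.logb 2 n)

/-- Immediate neighbours of `x`: its R-neighbour, K-neighbour and two AL-neighbours. -/
def neighbors (n : ℕ) (c : Config n) (x : ZMod n) : List (ZMod n) :=
  [x + 1, c.K x, c.AL x 0, c.AL x 1]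

/-- Kleinberg greedy step: forward to the immediate neighbour closest to the target `t`. -/
def greedyNext (n : ℕ) (c : Config n) (t x : ZMod n) : ZMod n :=
  ((neighbors n c x).argmin fun y => ringDist n y t).getD x

/-- Position after `k` steps of Kleinberg's greedy routing towards `t`, started at `s`. -/
def greedyTraj (n : ℕ) (c : Config n) (t s : ZMod n) (k : ℕ) : ZMod n :=
  (greedyNext n c t)^[k] s

/-- `v` is an AL-neighbour of `u`. -/
def alStep (n : ℕ) (c : Config n) (u v : ZMod n) : Prop := c.AL u 0 = v ∨ c.AL u 1 = v

/-- `p` is a path of AL-links from `y` to `z` all of whose nodes lie in `S`. -/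
def isPath (n : ℕ) (c : Config n) (S : Finset (ZMod n)) (y z : ZMod n)
    (p : List (ZMod n)) : Prop :=
  p.head? = some y ∧ p.getLast? = some z ∧ p.Chain' (alStep n c) ∧ ∀ v ∈ p, v ∈ S

/-- A shortest AL-path from `y` to `z` inside `S` (the empty list if none exists). -/
def shortestPath (n : ℕ) (c : Config n) (S : Finset (ZMod n)) (y z : ZMod n) :
    List (ZMod n) :=
  if h : ∃ p, isPath n c S y z p ∧ ∀ q, isPath n c S y z q → p.length ≤ q.length
  then h.choose else []

/-- A node `z` in `A_y(⌈log₂ log₂ n⌉)` whose K-neighbour is closest to `t`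
(ties broken by a fixed rule). -/
def chooseZ (n : ℕ) (c : Config n) (t y : ZMod n) : ZMod n :=
  (((aware n c y (kstar n)).toList.argmin fun z => ringDist n (c.K z) t).getD y)

/-- One step of Algorithm 1 (non-oblivious routing); the state is the pair
(current node, header stack). -/
def step1 (n : ℕ) (c : Config n) (t : ZMod n) :
    ZMod n × List (ZMod n) → ZMod n × List (ZMod n) := fun st =>
  if (ringDist n st.1 t : ℝ) ≥ thresh n then
    match st.2 with
    | [] =>
      let y := c.K st.1
      let z := chooseZ n c t y
      (y, (shortestPath n c (aware n c y (kstar n)) y z).tail)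
    | v :: rest => (v, rest)
  else (greedyNext n c t st.1, [])

/-- Position after `k` hops of Algorithm 1 towards `t`, started at `s` with empty stack. -/
def traj1 (n : ℕ) (c : Config n) (t s : ZMod n) (k : ℕ) : ZMod n :=
  ((step1 n c t)^[k] (s, [])).1

/-- One step of Algorithm 2 (oblivious routing) with parameter `cp`. -/
def step2 (n : ℕ) (cp : ℝ) (c : Config n) (t x : ZMod n) : ZMod n :=
  if (ringDist n x t : ℝ) ≥ cp * thresh n then
    let S := aware n c x (kstar n)
    let cands := S.filter fun z => (ringDist n (c.K z) t : ℝ) ≤ (ringDist n x t : ℝ) / 2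
    match cands.toList.argmin fun z => (shortestPath n c S x z).length with
    | none => greedyNext n c t x
    | some z =>
      if z = x then c.K x
      else
        match shortestPath n c S x z with
        | _ :: v :: _ => v
        | _ => greedyNext n c t x
  else greedyNext n c t x

/-- Position after `k` hops of Algorithm 2 (parameter `cp`) towards `t`, started at `s`. -/
def traj2 (n : ℕ) (cp : ℝ) (c : Config n) (t s : ZMod n) (k : ℕ) : ZMod n :=
  (step2 n cp c t)^[k] s

/-- The first time `k` at which `P k` holds (`⊤` if it never does). -/
def hitTime (P : ℕ → Prop) : ℕ∞ := sInf {k : ℕ∞ | ∃ m : ℕ, P m ∧ k = m}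

/-- Expected number of hops until a trajectory first reaches the goal set,
over the random construction of the network. -/
def expHit (n : ℕ) (traj : Config n → ℕ → ZMod n) (Goal : ZMod n → Prop) : ℝ≥0∞ :=
  ∑' c : Config n,
    ENNReal.ofReal (configProb n c) * ((hitTime fun m => Goal (traj c m)) : ℝ≥0∞)

/-- Direction (±1) of the shorter arc from `x` to `t`. -/
def arcDir (n : ℕ) (x t : ZMod n) : ZMod n := if (t - x).val ≤ (x - t).val then 1 else -1

/-- The point at arc-length `i` from `x` along the shorter arc towards `t`. -/
def arcPoint (n : ℕ) (x t : ZMod n) (i : ℕ) : ZMod n := x + (i : ZMod n) * arcDir n x t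

end

theorem ringDist_eq_natAbs_valMinAbs {n : ℕ} [NeZero n] (u v : ZMod n) :
    ringDist n u v = (v - u).valMinAbs.natAbs := by
  rw [ZMod.valMinAbs_natAbs_eq_min, ringDist, ← neg_sub v u, ZMod.neg_val]
  split_ifs with h
  · simp [h]
  · rfl

theorem ringDist_triangle {n : ℕ} [NeZero n] (u v w : ZMod n) :
    ringDist n u w ≤ ringDist n u v + ringDist n v w := by
  simp only [ringDist_eq_natAbs_valMinAbs]
  rw [← sub_add_sub_cancel' v u w]
  exact (ZMod.natAbs_valMinAbs_add_le _ _).trans (Int.natAbs_add_le _ _)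

theorem ringDist_comm (n : ℕ) (u v : ZMod n) : ringDist n u v = ringDist n v u :=
  min_comm _ _

theorem ringDist_add_natCast_le {n : ℕ} (t : ZMod n) (i : ℕ) :
    ringDist n t (t + i) ≤ i := by
  rw [ringDist, add_sub_cancel_left]
  exact (min_le_left _ _).trans (by rw [ZMod.val_natCast]; exact Nat.mod_le _ _)

theorem ringDist_pos {n : ℕ} {u v : ZMod n} (h : v ≠ u) : 0 < ringDist n u v := by
  refine lt_min ?_ ?_ <;> rw [Nat.pos_iff_ne_zero, Ne, ZMod.val_eq_zero, sub_eq_zero]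
  · exact h
  · exact h.symm

theorem ringDist_lt {n : ℕ} [NeZero n] (u v : ZMod n) : ringDist n u v < n :=
  (min_le_left _ _).trans_lt (ZMod.val_lt _)

theorem sum_inv_val_le {n : ℕ} [NeZero n] :
    ∑ z : ZMod n, ((z.val : ℝ))⁻¹ ≤ 1 + Real.log n := by
  have h1 : ∑ z : ZMod n, ((z.val : ℝ))⁻¹ = ∑ i ∈ Finset.range n, ((i : ℝ))⁻¹ := by
    refine Finset.sum_bij (fun z _ => z.val) (fun z _ => Finset.mem_range.2 (ZMod.val_lt z))
      (fun a _ b _ h => ZMod.val_injective n h)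
      (fun i hi => ⟨i, Finset.mem_univ _, ZMod.val_cast_of_lt (Finset.mem_range.1 hi)⟩)
      (fun _ _ => rfl)
  have h2 := harmonic_le_one_add_log n
  have h3 : ((harmonic n : ℚ) : ℝ) = ∑ i ∈ Finset.range (n + 1), ((i : ℝ))⁻¹ := by
    rw [Finset.sum_range_succ', harmonic]
    push_cast
    simp
  rw [h1]
  refine le_trans ?_ (h3 ▸ h2)
  rw [Finset.sum_range_succ]
  have : (0 : ℝ) ≤ ((n : ℝ))⁻¹ := by positivity
  linarith

theorem Zconst_le {n : ℕ} [NeZero n] (u : ZMod n) : Zconst n u ≤ 2 * (1 + Real.log n) := by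
  rw [Zconst, tsum_fintype]
  have key : ∀ z : ZMod n, (if z = u then 0 else ((ringDist n u z : ℝ))⁻¹) ≤
      (((z - u).val : ℝ))⁻¹ + (((u - z).val : ℝ))⁻¹ := by
    intro z
    have h1 : (0 : ℝ) ≤ (((z - u).val : ℝ))⁻¹ := by positivity
    have h2 : (0 : ℝ) ≤ (((u - z).val : ℝ))⁻¹ := by positivity
    split_ifs with h
    · positivity
    · rw [ringDist]
      rcases min_choice (z - u).val (u - z).val with h' | h' <;> rw [h'] <;> linarith
  refine (Finset.sum_le_sum fun z _ => key z).trans ?_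
  have h1 := Equiv.sum_comp (Equiv.subRight u) (fun z : ZMod n => ((z.val : ℝ))⁻¹)
  have h2 := Equiv.sum_comp (Equiv.subLeft u) (fun z : ZMod n => ((z.val : ℝ))⁻¹)
  simp only [Equiv.subRight_apply, Equiv.subLeft_apply] at h1 h2
  rw [Finset.sum_add_distrib, h1, h2]
  linarith [sum_inv_val_le (n := n)]

theorem Zconst_pos {n : ℕ} [NeZero n] {u v : ZMod n} (h : v ≠ u) : 0 < Zconst n u := by
  rw [Zconst, tsum_fintype]
  refine Finset.sum_pos' (fun z _ => by split_ifs <;> positivity) ⟨v, Finset.mem_univ _, ?_⟩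
  rw [if_neg h]
  have := ringDist_pos h
  positivity

theorem kProb_nonneg {n : ℕ} [NeZero n] (u v : ZMod n) : 0 ≤ kProb n u v := by
  rw [kProb]
  split_ifs with h
  · exact le_rfl
  · have := Zconst_pos h
    positivity

theorem sum_kProb {n : ℕ} [NeZero n] (hn : 2 ≤ n) (u : ZMod n) : ∑ v, kProb n u v = 1 := by
  have : Fact (1 < n) := ⟨hn⟩
  have hZ : Zconst n u ≠ 0 := (Zconst_pos (v := u + 1) (by simp)).ne'
  have h : ∀ v, kProb n u v =
      (Zconst n u)⁻¹ * (if v = u then 0 else ((ringDist n u v : ℝ))⁻¹) := by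
    intro v
    rw [kProb]
    split_ifs <;> simp [mul_comm]
  rw [Finset.sum_congr rfl fun v _ => h v, ← Finset.mul_sum]
  have hs : Zconst n u = ∑ v, (if v = u then 0 else ((ringDist n u v : ℝ))⁻¹) := by
    rw [Zconst, tsum_fintype]
  rw [← hs, inv_mul_cancel₀ hZ]

theorem sum_alProb {n : ℕ} [NeZero n] (h0 : 0 < alCount n) (h : alCount n ≤ n) (u : ZMod n) :
    ∑ v, alProb n u v = 1 := by
  have hinj : Set.InjOn (fun i : ℕ => u + (i : ZMod n)) (Finset.Icc 1 (alCount n)) := by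
    intro i hi j hj hij
    simp only [Finset.coe_Icc, Set.mem_Icc] at hi hj
    have h1 : ((i - 1 : ℕ) : ZMod n) = ((j - 1 : ℕ) : ZMod n) := by
      rw [Nat.cast_sub hi.1, Nat.cast_sub hj.1, add_left_cancel hij]
    have h2 := congrArg ZMod.val h1
    rw [ZMod.val_cast_of_lt (by omega), ZMod.val_cast_of_lt (by omega)] at h2
    omega
  have hf : ∑ v, alProb n u v =
      ∑ v ∈ (Finset.Icc 1 (alCount n)).image (fun i : ℕ => u + (i : ZMod n)),
        ((alCount n : ℝ))⁻¹ := by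
    rw [← Finset.sum_subset (Finset.subset_univ _)]
    · exact Finset.sum_congr rfl fun v hv => if_pos (Finset.mem_image.1 hv)
    · exact fun v _ hv => if_neg fun h => hv (Finset.mem_image.2 h)
  rw [hf, Finset.sum_const, Finset.card_image_of_injOn hinj, Nat.card_Icc]
  have : (alCount n : ℝ) ≠ 0 := by positivity
  simp [this]

theorem sum_prod_alProb {n : ℕ} [NeZero n] (h0 : 0 < alCount n) (h : alCount n ≤ n) :
    ∑ a : ZMod n → Fin 2 → ZMod n, ∏ u, (alProb n u (a u 0) * alProb n u (a u 1)) = 1 := by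
  have h1 : ∀ u : ZMod n, ∑ b : Fin 2 → ZMod n, alProb n u (b 0) * alProb n u (b 1) = 1 := by
    intro u
    have := Fintype.prod_sum (fun (_ : Fin 2) (v : ZMod n) => alProb n u v)
    simpa [sum_alProb h0 h] using this.symm
  rw [← Fintype.prod_sum (fun (u : ZMod n) (b : Fin 2 → ZMod n) =>
    alProb n u (b 0) * alProb n u (b 1))]
  simp [h1]

theorem sum_prod_kProb {n : ℕ} [NeZero n] (hn : 2 ≤ n) (x : ZMod n) (P : ZMod n → Prop) :
    ∑ k : ZMod n → ZMod n, (if P (k x) then ∏ u, kProb n u (k u) else 0) =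
      ∑ v, if P v then kProb n x v else 0 := by
  have h1 : ∀ k : ZMod n → ZMod n, (if P (k x) then ∏ u, kProb n u (k u) else 0) =
      ∏ u, (if u = x ∧ ¬ P (k u) then 0 else kProb n u (k u)) := by
    intro k
    split_ifs with h
    · refine Finset.prod_congr rfl fun u _ => ?_
      rw [if_neg]
      rintro ⟨rfl, h'⟩
      exact h' h
    · exact (Finset.prod_eq_zero (Finset.mem_univ x) (by simp [h])).symm
  rw [Finset.sum_congr rfl fun k _ => h1 k,
    ← Fintype.prod_sum (fun u v : ZMod n => if u = x ∧ ¬ P v then 0 else kProb n u v),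
    Fintype.prod_eq_single x]
  · refine Finset.sum_congr rfl fun v _ => ?_
    by_cases h : P v <;> simp [h]
  · intro u hu
    simp [hu, sum_kProb hn]

/-- A configuration is a choice of K-links together with a choice of AL-links. -/
def configEquiv (n : ℕ) : Config n ≃ (ZMod n → ZMod n) × (ZMod n → Fin 2 → ZMod n) where
  toFun c := (c.K, c.AL)
  invFun p := ⟨p.1, p.2⟩
  left_inv _ := rfl
  right_inv _ := rfl

/-- The K-neighbour of `x` is distributed according to `kProb n x`. -/
theorem Pr_kLink {n : ℕ} [NeZero n] (hn : 2 ≤ n) (h0 : 0 < alCount n) (h : alCount n ≤ n)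
    (x : ZMod n) (P : ZMod n → Prop) :
    Pr n (fun c => P (c.K x)) = ∑ v, if P v then kProb n x v else 0 := by
  rw [Pr, ← (configEquiv n).symm.tsum_eq, tsum_fintype, Fintype.sum_prod_type,
    ← sum_prod_kProb hn x P]
  refine Finset.sum_congr rfl fun k _ => ?_
  simp only [configEquiv, Equiv.coe_fn_symm_mk, configProb, tprod_fintype]
  split_ifs with hP
  · rw [← Finset.mul_sum, sum_prod_alProb h0 h, mul_one]
  · simp

theorem inv_le_sum_kProb {n : ℕ} [NeZero n] (x t : ZMod n) (hxt : 2 ≤ ringDist n x t) :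
    (3 * Zconst n x)⁻¹ ≤
      ∑ v, if (ringDist n v t : ℝ) ≤ (ringDist n x t : ℝ) / 2 then kProb n x v else 0 := by
  set m := ringDist n x t with hm
  have hmn : m < n := ringDist_lt x t
  have htx : t ≠ x := by
    rintro rfl
    simp [ringDist] at hm
    omega
  have hZ : 0 < Zconst n x := Zconst_pos htx
  have hinj : Set.InjOn (fun i : ℕ => t + (i : ZMod n)) (Finset.range (m / 2 + 1)) := by
    intro i hi j hj hij
    simp only [Finset.coe_range, Set.mem_Iio] at hi hj
    have h2 := congrArg ZMod.val (add_left_cancel hij)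
    rwa [ZMod.val_cast_of_lt (by omega), ZMod.val_cast_of_lt (by omega)] at h2
  have hterm : ∀ i ∈ Finset.range (m / 2 + 1), (Zconst n x * (3 * m / 2))⁻¹ ≤
      if (ringDist n (t + (i : ZMod n)) t : ℝ) ≤ (m : ℝ) / 2
        then kProb n x (t + (i : ZMod n)) else 0 := by
    intro i hi
    have hi' : 2 * i ≤ m := by
      have := Finset.mem_range.1 hi
      omega
    have h1 : ringDist n t (t + (i : ZMod n)) ≤ i := ringDist_add_natCast_le t i
    have hiR : (i : ℝ) ≤ m / 2 := by
      have : (2 * i : ℝ) ≤ m := by exact_mod_cast hi'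
      linarith
    have h1R : (ringDist n t (t + (i : ZMod n)) : ℝ) ≤ i := by exact_mod_cast h1
    have hne : t + (i : ZMod n) ≠ x := by
      intro h
      rw [h, ringDist_comm, ← hm] at h1
      omega
    have h2 : (ringDist n x (t + (i : ZMod n)) : ℝ) ≤ m + i := by
      exact_mod_cast (ringDist_triangle x t _).trans (Nat.add_le_add_left h1 _)
    have hpos : (0 : ℝ) < ringDist n x (t + (i : ZMod n)) := by
      exact_mod_cast ringDist_pos hne
    rw [if_pos (by rw [ringDist_comm]; linarith), kProb, if_neg hne]
    gcongr
    linarith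
  have hmR : (0 : ℝ) < m := by
    have : 0 < m := by omega
    exact_mod_cast this
  have hcard : (m : ℝ) / 2 ≤ ((m / 2 + 1 : ℕ) : ℝ) := by
    have : m ≤ 2 * (m / 2 + 1) := by omega
    have : (m : ℝ) ≤ 2 * ((m / 2 + 1 : ℕ) : ℝ) := by exact_mod_cast this
    linarith
  calc (3 * Zconst n x)⁻¹ = (m : ℝ) / 2 * (Zconst n x * (3 * m / 2))⁻¹ := by
        field_simp
    _ ≤ ((m / 2 + 1 : ℕ) : ℝ) * (Zconst n x * (3 * m / 2))⁻¹ := by gcongr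
    _ = ∑ _i ∈ Finset.range (m / 2 + 1), (Zconst n x * (3 * m / 2))⁻¹ := by simp
    _ ≤ _ := Finset.sum_le_sum hterm
    _ = ∑ v ∈ (Finset.range (m / 2 + 1)).image (fun i : ℕ => t + (i : ZMod n)),
          if (ringDist n v t : ℝ) ≤ (m : ℝ) / 2 then kProb n x v else 0 :=
        (Finset.sum_image (f := fun v => if (ringDist n v t : ℝ) ≤ (m : ℝ) / 2
          then kProb n x v else 0) hinj).symm
    _ ≤ _ := Finset.sum_le_sum_of_subset_of_nonneg (Finset.subset_univ _) fun v _ _ => by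
        split_ifs
        · exact kProb_nonneg x v
        · exact le_rfl

theorem alCount_le {n : ℕ} (hn : 1600 ≤ n) : alCount n ≤ n := by
  have hnR : (1600 : ℝ) ≤ n := by exact_mod_cast hn
  have hn0 : (0 : ℝ) ≤ n := by linarith
  set y : ℝ := (n : ℝ) ^ (1 / 4 : ℝ) with hy
  have hy0 : 0 ≤ y := by positivity
  have hy4 : y ^ 4 = n := by
    rw [hy, ← Real.rpow_natCast, ← Real.rpow_mul hn0]
    norm_num
  have hy2 : 40 ≤ y ^ 2 := by nlinarith [sq_nonneg y]
  have hlog : Real.log n ≤ 4 * y := by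
    have := Real.log_le_rpow_div hn0 (by norm_num : (0 : ℝ) < 1 / 4)
    linarith
  have hlogb : Real.logb 2 n ≤ 6 * y := by
    rw [Real.logb, div_le_iff₀ (Real.log_pos one_lt_two)]
    nlinarith [Real.log_two_gt_d9]
  have hlogb0 : 0 ≤ Real.logb 2 n := Real.logb_nonneg one_lt_two (by linarith)
  refine Nat.ceil_le.2 ?_
  calc Real.logb 2 n ^ 2 ≤ (6 * y) ^ 2 := by gcongr
    _ ≤ y ^ 4 := by nlinarith
    _ = n := hy4

/-- There is a constant `c3 > 0` such that for all sufficiently large `n`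
and nodes `x, t` with `m = Dist(x,t) ≥ 2`, the probability that the K-neighbour of `x`
lies in the ball `B_{m/2}(t)` is at least `c3 / log₂ n`. -/
theorem kLink_halves_distance :
    ∃ c3 : ℝ, 0 < c3 ∧ ∃ N : ℕ, ∀ n : ℕ, N ≤ n → ∀ x t : ZMod n,
      2 ≤ ringDist n x t →
      c3 / Real.logb 2 n ≤
        Pr n (fun c => (ringDist n (c.K x) t : ℝ) ≤ (ringDist n x t : ℝ) / 2) := by
  refine ⟨1 / 12, by norm_num, 1600, fun n hn x t hxt => ?_⟩
  have hn3 : 3 ≤ n := by omega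
  have : NeZero n := ⟨by omega⟩
  have hnR : (3 : ℝ) ≤ n := by exact_mod_cast hn3
  have hlog : 1 ≤ Real.logb 2 n := by
    rw [Real.le_logb_iff_rpow_le one_lt_two (by linarith)]
    norm_num
    linarith
  have h0 : 0 < alCount n := Nat.ceil_pos.2 (by positivity)
  rw [Pr_kLink (by omega) h0 (alCount_le hn) x
    (fun v => (ringDist n v t : ℝ) ≤ (ringDist n x t : ℝ) / 2)]
  refine le_trans ?_ (inv_le_sum_kProb x t hxt)
  have htx : t ≠ x := by
    rintro rfl
    simp [ringDist] at hxt
  have hZ : 0 < Zconst n x := Zconst_pos htx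
  have hle : Real.log n ≤ Real.logb 2 n := by
    rw [Real.logb, le_div_iff₀ (Real.log_pos one_lt_two)]
    have := Real.log_two_lt_d9
    have := Real.log_nonneg (by linarith : (1 : ℝ) ≤ n)
    nlinarith
  rw [div_div, one_div]
  exact inv_anti₀ (by positivity) (by linarith [Zconst_le x])
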